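/- arXiv:1712.02041 — 2 statements merged into one kernel-verified Lean document; each statement's English description precedes it below -/
import Mathlib

section
/- If log φ is locally Hölder continuous, then there exists a constant C_φ ≥ 1 such that for every n ≥ 1, every admissible word w of length n and all x, y ∈ θ^n([w]), one has |Φ_w(x)/Φ_w(y) − 1| ≤ C_φ · d_r(x,y) and Φ_w(x)/Φ_w(y) ≤ C_φ. -/
open MeasureTheory Filter Topology

namespace GroupExt

variable {W : Type*} {G : Type*} [Group G]

/-- The one-sided topological Markov chain with alphabet `W` and transition relation `A`. -/
abbrev ShiftSpace (A : W → W → Prop) : Type _ := {x : ℕ → W // ∀ i, A (x i) (x (i + 1))}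

variable {A : W → W → Prop}

/-- The shift map. -/
def shift (x : ShiftSpace A) : ShiftSpace A :=
  ⟨fun i => x.1 (i + 1), fun i => x.2 (i + 1)⟩

/-- `w 0, …, w (n-1)` is an admissible word of length `n`. -/
def IsWord (A : W → W → Prop) (n : ℕ) (w : ℕ → W) : Prop :=
  ∀ i, i + 1 < n → A (w i) (w (i + 1))

/-- The cylinder of the word `w 0, …, w (n-1)`. -/
def cyl (A : W → W → Prop) (n : ℕ) (w : ℕ → W) : Set (ShiftSpace A) :=
  {x | ∀ i < n, x.1 i = w i}

/-- The Birkhoff product `Φ_n = ∏_{k<n} φ ∘ θ^k`. -/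
noncomputable def birk (φ : ShiftSpace A → ℝ) (n : ℕ) (x : ShiftSpace A) : ℝ :=
  ∏ k ∈ Finset.range n, φ (shift^[k] x)

open Classical in
/-- The shift metric `d_r(x, y) = r^{min {i : x_i ≠ y_i}}`. -/
noncomputable def dr (r : ℝ) (x y : ShiftSpace A) : ℝ :=
  if h : x = y then 0
  else r ^ Nat.find (show ∃ n, x.1 n ≠ y.1 n from by
    by_contra hc
    push_neg at hc
    exact h (Subtype.ext (funext hc)))

/-- `f` is locally Hölder continuous with constant `C₀` and exponent (ratio) `r`:
`V_n(f) ≤ C₀ r^n` for all `n ≥ 1`. -/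
def LocHolder (r C₀ : ℝ) (f : ShiftSpace A → ℝ) : Prop :=
  ∀ n : ℕ, 1 ≤ n → ∀ x y : ShiftSpace A, (∀ i < n, x.1 i = y.1 i) → |f x - f y| ≤ C₀ * r ^ n

/-- Topological mixing of the topological Markov chain. -/
def Mixing (A : W → W → Prop) : Prop :=
  ∀ a b : W, ∃ N : ℕ, ∀ n ≥ N, ∃ x : ShiftSpace A, x.1 0 = a ∧ (shift^[n] x).1 0 = b

/-- The big images and preimages property. -/
def BIP (A : W → W → Prop) : Prop :=
  Mixing A ∧ ∃ I : Finset W, ∀ v : W, ∃ b₁ ∈ I, ∃ b₂ ∈ I, A v b₁ ∧ A b₂ v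

/-- The `n`-th iterate of the Ruelle operator of the base shift,
`L_φ^n f (x) = ∑_{θ^n y = x} Φ_n(y) f(y)`. -/
noncomputable def LNbase (φ : ShiftSpace A → ℝ) (n : ℕ) (f : ShiftSpace A → ℝ)
    (x : ShiftSpace A) : ℝ :=
  ∑' y : {y : ShiftSpace A // shift^[n] y = x}, birk φ n y.1 * f y.1

/-- The group extension `T(x, g) = (θ x, g ψ(x))`. -/
def ext (ψ : ShiftSpace A → G) (z : ShiftSpace A × G) : ShiftSpace A × G :=
  (shift z.1, z.2 * ψ z.1)

/-- `ψ_n(x) = ψ(x) ψ(θ x) ⋯ ψ(θ^{n-1} x)`. -/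
def psin (ψ : ShiftSpace A → G) (n : ℕ) (x : ShiftSpace A) : G :=
  ((List.range n).map fun k => ψ (shift^[k] x)).prod

/-- The fiber `X_g = Σ × {g}`. -/
def fiber (A : W → W → Prop) (g : G) : Set (ShiftSpace A × G) := {z | z.2 = g}

/-- The `n`-th iterate of the Ruelle operator of the group extension. -/
noncomputable def LNext (φ : ShiftSpace A → ℝ) (ψ : ShiftSpace A → G) (n : ℕ)
    (f : ShiftSpace A × G → ℝ) (z : ShiftSpace A × G) : ℝ :=
  ∑' y : {y : ShiftSpace A × G // (ext ψ)^[n] y = z}, birk φ n y.1.1 * f y.1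

/-- `Z^n(ξ) = ∑_{θ^n x = ξ, ψ_n(x) = id} Φ_n(x)`. -/
noncomputable def Zn (φ : ShiftSpace A → ℝ) (ψ : ShiftSpace A → G) (ξ : ShiftSpace A)
    (n : ℕ) : ℝ :=
  ∑' x : {x : ShiftSpace A // shift^[n] x = ξ ∧ psin ψ n x = 1}, birk φ n x.1

/-- `∑_{θ^n x = ξ, ψ_n(x) = id} Φ_n(x) f(x)`, the sum defining `m_s` tested against `f`
(restricted to the fiber of the identity). -/
noncomputable def ZnF (φ : ShiftSpace A → ℝ) (ψ : ShiftSpace A → G) (ξ : ShiftSpace A)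
    (n : ℕ) (f : ShiftSpace A → ℝ) : ℝ :=
  ∑' x : {x : ShiftSpace A // shift^[n] x = ξ ∧ psin ψ n x = 1}, birk φ n x.1 * f x.1

/-- Topological transitivity of the group extension. -/
def TransitiveExt (ψ : ShiftSpace A → G) : Prop :=
  ∀ (a b : W) (g h : G), ∃ (n : ℕ) (z : ShiftSpace A × G),
    z.1.1 0 = a ∧ z.2 = g ∧ ((ext ψ)^[n] z).1.1 0 = b ∧ ((ext ψ)^[n] z).2 = h

/-- `ν` is a `D`-conformal measure for `T`: `ν(T(E)) = ∫_E D dν` whenever `T|_E` is injective. -/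
def Conformal {α : Type*} [MeasurableSpace α] (T : α → α) (D : α → ℝ)
    (ν : Measure α) : Prop :=
  ∀ E : Set α, MeasurableSet E → Set.InjOn T E →
    ν (T '' E) = ∫⁻ x in E, ENNReal.ofReal (D x) ∂ν

open Classical in
/-- The metric on `X = Σ × G`. -/
noncomputable def dX (r : ℝ) (z₁ z₂ : ShiftSpace A × G) : ℝ :=
  if z₁.2 = z₂.2 then dr r z₁.1 z₂.1 else 1

/-- The Vaserstein distance, via Kantorovich duality. -/
noncomputable def Wdist [MeasurableSpace W] [MeasurableSpace G] [TopologicalSpace W] (r : ℝ)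
    (μ₁ μ₂ : Measure (ShiftSpace A × G)) [TopologicalSpace G] : ℝ :=
  sSup {t | ∃ f : ShiftSpace A × G → ℝ, Continuous f ∧
    (∀ ζ ζ', |f ζ - f ζ'| ≤ dX r ζ ζ') ∧ t = (∫ z, f z ∂μ₁) - ∫ z, f z ∂μ₂}

/-- The two-sided space of the natural extension of the group extension. -/
abbrev NatExt (A : W → W → Prop) (ψ₀ : W → G) : Type _ :=
  {y : ℤ → W × G // ∀ i : ℤ, A (y i).1 (y (i + 1)).1 ∧ (y (i + 1)).2 = (y i).2 * ψ₀ (y i).1}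

/-- The (invertible) shift on the natural extension; `Sshift ψ₀ k = S^k`. -/
def Sshift (ψ₀ : W → G) (k : ℤ) (y : NatExt A ψ₀) : NatExt A ψ₀ :=
  ⟨fun i => y.1 (i + k), fun i => by
    have h := y.2 (i + k)
    have e : i + 1 + k = i + k + 1 := by ring
    simpa only [e] using h⟩

/-- The projection `π : Y → X`. -/
def proj (ψ₀ : W → G) (y : NatExt A ψ₀) : ShiftSpace A × G :=
  (⟨fun n => (y.1 (n : ℤ)).1, fun n => by
    have h := (y.2 (n : ℤ)).1
    have e : ((n : ℤ)) + 1 = ((n + 1 : ℕ) : ℤ) := by push_cast; ring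
    rw [e] at h
    exact h⟩, (y.1 0).2)

/-- A cylinder of the natural extension, based at time `k`. -/
def natCyl (ψ₀ : W → G) (k : ℤ) (n : ℕ) (ω : ℕ → W × G) : Set (NatExt A ψ₀) :=
  {y | ∀ j : ℕ, j ≤ n → y.1 (k + j) = ω j}

/-- The reversed word `w† = (w_{n-1}†, …, w_0†)`. -/
def dagWord (dag : W → W) (n : ℕ) (w : ℕ → W) : ℕ → W := fun i => dag (w (n - 1 - i))

/-- `(Σ, θ, ψ)` is a symmetric group extension (with `ψ` induced by `ψ₀` on letters). -/
def SymmetricExt (A : W → W → Prop) (ψ₀ : W → G) (dag : W → W) : Prop :=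
  (∀ v, dag (dag v) = v) ∧ (∀ v w, A v w ↔ A (dag w) (dag v)) ∧
    ∀ v, ψ₀ (dag v) = (ψ₀ v)⁻¹

/-- Symmetry of the potential: `Φ_n(x) ≤ B Φ_n(y)` for `x ∈ [w]`, `y ∈ [w†]`. -/
def SymmetricPot (A : W → W → Prop) (φ : ShiftSpace A → ℝ) (dag : W → W) : Prop :=
  ∃ B : ℝ, ∀ n w, IsWord A n w →
    ∀ x ∈ cyl A n w, ∀ y ∈ cyl A n (dagWord dag n w), birk φ n x ≤ B * birk φ n y

lemma shift_iterate_apply (k : ℕ) (x : ShiftSpace A) (i : ℕ) :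
    (shift^[k] x).1 i = x.1 (i + k) := by
  induction k generalizing x with
  | zero => rfl
  | succ k ih =>
    rw [Function.iterate_succ_apply, ih]
    exact congrArg x.1 (by omega)

lemma birk_succ (φ : ShiftSpace A → ℝ) (n : ℕ) (x : ShiftSpace A) :
    birk φ (n + 1) x = birk φ n x * φ (shift^[n] x) :=
  Finset.prod_range_succ _ _

lemma birk_pos {φ : ShiftSpace A → ℝ} (hφ : ∀ x, 0 < φ x) (n : ℕ) (x : ShiftSpace A) :
    0 < birk φ n x :=
  Finset.prod_pos fun _ _ => hφ _

/-- Bounded distortion: if `x` and `y` agree on their first `n + m` letters, then the logarithms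
of the Birkhoff products of length `n` differ by at most a constant times `r ^ m`. -/
lemma abs_log_birk_sub_le {r C₀ : ℝ} (hr0 : 0 < r) (hr1 : r < 1) {φ : ShiftSpace A → ℝ}
    (hφ : ∀ x, 0 < φ x) (hH : LocHolder r C₀ (fun x => Real.log (φ x))) (n m : ℕ)
    {x y : ShiftSpace A} (hxy : ∀ i < n + m, x.1 i = y.1 i) :
    |Real.log (birk φ n x) - Real.log (birk φ n y)| ≤ |C₀| / (1 - r) * r ^ m := by
  have hr : 0 < 1 - r := sub_pos.2 hr1
  induction n generalizing m with
  | zero =>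
    simp only [birk, Finset.range_zero, Finset.prod_empty, sub_self, abs_zero]
    positivity
  | succ n ih =>
    have h₁ := ih (m + 1) fun i hi => hxy i (by omega)
    have h₂ := hH (m + 1) (by omega) (shift^[n] x) (shift^[n] y) fun i hi => by
      rw [shift_iterate_apply, shift_iterate_apply]
      exact hxy _ (by omega)
    have h₃ : C₀ * r ^ (m + 1) ≤ |C₀| * r ^ (m + 1) := by
      gcongr
      exact le_abs_self C₀
    rw [birk_succ, birk_succ, Real.log_mul (birk_pos hφ n x).ne' (hφ _).ne',
      Real.log_mul (birk_pos hφ n y).ne' (hφ _).ne', add_sub_add_comm]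
    calc _ ≤ |C₀| / (1 - r) * r ^ (m + 1) + |C₀| * r ^ (m + 1) :=
          (abs_add_le _ _).trans (add_le_add h₁ (h₂.trans h₃))
      _ = |C₀| / (1 - r) * r ^ m * (1 - (1 - r) ^ 2) := by
          field_simp
          ring
      _ ≤ |C₀| / (1 - r) * r ^ m :=
          mul_le_of_le_one_right (by positivity) (sub_le_self _ (sq_nonneg _))

lemma abs_exp_sub_one_le_mul_exp (t : ℝ) : |Real.exp t - 1| ≤ |t| * Real.exp |t| := by
  have h₁ : t + 1 ≤ Real.exp t := Real.add_one_le_exp t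
  have h₂ : Real.exp t * (-t + 1) ≤ 1 := by
    calc Real.exp t * (-t + 1) ≤ Real.exp t * Real.exp (-t) := by
          gcongr
          exact Real.add_one_le_exp (-t)
      _ = 1 := by rw [← Real.exp_add, add_neg_cancel, Real.exp_zero]
  have h₃ : |t| ≤ |t| * Real.exp |t| :=
    le_mul_of_one_le_right (abs_nonneg t) (Real.one_le_exp (abs_nonneg t))
  have h₄ : t * Real.exp t ≤ |t| * Real.exp |t| := by
    gcongr <;> exact le_abs_self t
  rw [abs_le]
  constructor <;> linarith [neg_abs_le t]

/-- Distinct points are at distance `r ^ m`, where `m` is the length of their common prefix. -/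
lemma exists_dr_eq_pow (r : ℝ) {x y : ShiftSpace A} (h : x ≠ y) :
    ∃ m : ℕ, dr r x y = r ^ m ∧ ∀ i < m, x.1 i = y.1 i := by
  classical
  rw [dr, dif_neg h]
  exact ⟨_, rfl, fun i hi => not_not.1 (Nat.find_min _ hi)⟩

/-- If `log φ` is locally Hölder continuous then there is `C_φ ≥ 1` such that, for every
admissible word `w` of length `n` and all points `x = θ^n x'`, `y = θ^n y'` of `θ^n([w])`
(with `x' = τ_w(x), y' = τ_w(y) ∈ [w]` the corresponding preimages),
`|Φ_w(x)/Φ_w(y) − 1| ≤ C_φ d_r(x,y)` and `Φ_w(x)/Φ_w(y) ≤ C_φ`. -/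
theorem birk_ratio_bound (r C₀ : ℝ) (hr0 : 0 < r) (hr1 : r < 1)
    (φ : ShiftSpace A → ℝ) (hφ : ∀ x, 0 < φ x)
    (hH : LocHolder r C₀ (fun x => Real.log (φ x))) :
    ∃ C : ℝ, 1 ≤ C ∧ ∀ n : ℕ, 1 ≤ n → ∀ w : ℕ → W, IsWord A n w →
      ∀ x' ∈ cyl A n w, ∀ y' ∈ cyl A n w,
        |birk φ n x' / birk φ n y' - 1| ≤ C * dr r (shift^[n] x') (shift^[n] y') ∧
        birk φ n x' / birk φ n y' ≤ C := by
  have hr : 0 < 1 - r := sub_pos.2 hr1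
  set L := |C₀| / (1 - r) with hL
  have hL0 : 0 ≤ L := by positivity
  have hexp : 1 ≤ Real.exp L := Real.one_le_exp hL0
  have hC : Real.exp L ≤ (1 + L) * Real.exp L :=
    le_mul_of_one_le_left (Real.exp_pos L).le (by linarith)
  refine ⟨(1 + L) * Real.exp L, hexp.trans hC, ?_⟩
  intro n _ w _ x hx y hy
  have hxpos := birk_pos hφ n x
  have hypos := birk_pos hφ n y
  have hpre : ∀ i < n, x.1 i = y.1 i := fun i hi => (hx i hi).trans (hy i hi).symm
  have hagree : ∀ m, (∀ i < m, (shift^[n] x).1 i = (shift^[n] y).1 i) →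
      ∀ i < n + m, x.1 i = y.1 i := by
    intro m hm i hi
    rcases lt_or_ge i n with h | h
    · exact hpre i h
    · have := hm (i - n) (by omega)
      rwa [shift_iterate_apply, shift_iterate_apply, Nat.sub_add_cancel h] at this
  by_cases h : shift^[n] x = shift^[n] y
  · have hxy : x = y := Subtype.ext <| funext fun i =>
      hagree (i + 1) (fun j _ => by rw [h]) i (by omega)
    subst hxy
    rw [div_self hxpos.ne']
    exact ⟨by simp [dr], hexp.trans hC⟩
  · obtain ⟨m, hdr, hm⟩ := exists_dr_eq_pow r h
    have hlog := abs_log_birk_sub_le hr0 hr1 hφ hH n m (hagree m hm)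
    rw [← hL] at hlog
    set t := Real.log (birk φ n x) - Real.log (birk φ n y) with ht
    have hratio : birk φ n x / birk φ n y = Real.exp t := by
      rw [ht, Real.exp_sub, Real.exp_log hxpos, Real.exp_log hypos]
    have htL : |t| ≤ L :=
      hlog.trans (mul_le_of_le_one_right hL0 (pow_le_one₀ hr0.le hr1.le))
    rw [hratio, hdr]
    refine ⟨?_, (Real.exp_le_exp.2 ((le_abs_self t).trans htL)).trans hC⟩
    calc |Real.exp t - 1| ≤ |t| * Real.exp |t| := abs_exp_sub_one_le_mul_exp t
      _ ≤ L * r ^ m * Real.exp L := by gcongr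
      _ ≤ (1 + L) * r ^ m * Real.exp L := by
          gcongr
          linarith
      _ = (1 + L) * Real.exp L * r ^ m := by ring

end GroupExt
end

section
/- Suppose ρ < ∞ and suppose that for a sequence s_l ↓ ρ the probability measures m_{s_l}, viewed as measures on Σ via the identification Σ ≅ X_id, converge weak* to a probability measure m on Σ. Then for every Borel set B ⊆ Σ and every k ∈ ℕ such that T^k restricted to B × {id} is injective and T^k(B × {id}) ⊆ X_id, one has m(θ^k(B)) = ∫_B ρ^k / Φ_k dm. -/
open MeasureTheory Filter Topology

namespace GroupExt

variable {W : Type*} {G : Type*} [Group G]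

variable {A : W → W → Prop}

/-- Weights with `b n / b (n + 1) → 1` are asymptotically invariant under translation. -/
lemma tendsto_div_add {b : ℕ → ℝ} (hb1 : ∀ n, 1 ≤ b n)
    (hbq : Tendsto (fun n => b n / b (n + 1)) atTop (𝓝 1)) (k : ℕ) :
    Tendsto (fun n => b n / b (n + k)) atTop (𝓝 1) := by
  have hb : ∀ n, b n ≠ 0 := fun n => (zero_lt_one.trans_le (hb1 n)).ne'
  induction k with
  | zero => simp [div_self (hb _)]
  | succ k ih =>
    have h2 := ih.mul (hbq.comp (tendsto_add_atTop_nat k))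
    rw [one_mul] at h2
    refine h2.congr fun n => ?_
    have := hb (n + k)
    have := hb (n + (k + 1))
    simp only [Function.comp, add_assoc]
    field_simp

/-- A power series with nonnegative coefficients that diverges at `ρ⁻¹` tends to infinity there. -/
lemma tendsto_tsum_div_pow_atTop {c : ℕ → ℝ} (hc : ∀ n, 0 ≤ c n) {ρ : ℝ} (hρ : 0 < ρ)
    (hdiv : ¬ Summable (fun n => c n / ρ ^ n))
    (hcon : ∀ t : ℝ, ρ < t → Summable (fun n => c n / t ^ n))
    {s : ℕ → ℝ} (hs : ∀ l, ρ < s l) (hst : Tendsto s atTop (𝓝 ρ)) :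
    Tendsto (fun l => ∑' n, c n / s l ^ n) atTop atTop := by
  have h0 : ∀ n, 0 ≤ c n / ρ ^ n := fun n => div_nonneg (hc n) (pow_pos hρ n).le
  have hdiv' := (not_summable_iff_tendsto_nat_atTop_of_nonneg h0).1 hdiv
  rw [tendsto_atTop]
  intro M
  obtain ⟨N, hN⟩ := (hdiv'.eventually_gt_atTop M).exists
  have hcont : Tendsto (fun l => ∑ n ∈ Finset.range N, c n / s l ^ n) atTop
      (𝓝 (∑ n ∈ Finset.range N, c n / ρ ^ n)) :=
    tendsto_finsetSum _ fun n _ => tendsto_const_nhds.div (hst.pow n) (pow_pos hρ n).ne'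
  filter_upwards [hcont.eventually_const_lt hN] with l hl
  refine hl.le.trans ((hcon _ (hs l)).sum_le_tsum _ fun n _ => ?_)
  exact div_nonneg (hc n) (pow_pos (hρ.trans (hs l)) n).le

/-- Translating the coefficients by `k` multiplies the limiting weighted mean by `ρ ^ k`. -/
lemma limit_translate {b c P : ℕ → ℝ} (hb1 : ∀ n, 1 ≤ b n) (hbmono : Monotone b)
    (hbq : Tendsto (fun n => b n / b (n + 1)) atTop (𝓝 1)) (hc : ∀ n, 0 ≤ c n)
    {ρ : ℝ} (hρ : 0 < ρ) {s : ℕ → ℝ} (hs : ∀ l, ρ < s l) (hst : Tendsto s atTop (𝓝 ρ))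
    (hP : Tendsto P atTop atTop) (k : ℕ) {M M' : ℝ}
    (hM : Tendsto (fun l => (∑' n, b n * c n / s l ^ n) / P l) atTop (𝓝 M))
    (hM' : Tendsto (fun l => (∑' n, b n * c (n + k) / s l ^ n) / P l) atTop (𝓝 M')) :
    M' = ρ ^ k * M := by
  have hb : ∀ n, 0 < b n := fun n => zero_lt_one.trans_le (hb1 n)
  have hs0 : ∀ l, 0 < s l := fun l => hρ.trans (hs l)
  set R : ℕ → ℝ := fun l => ∑' n, b n * c n / s l ^ n with hR
  set T : ℕ → ℝ := fun l => ∑' n, b n * c (n + k) / s l ^ (n + k) with hT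
  have hρk : ρ ^ k ≠ 0 := (pow_pos hρ k).ne'
  have hTlim : Tendsto (fun l => T l / P l) atTop (𝓝 (M' / ρ ^ k)) := by
    refine (hM'.div (hst.pow k) hρk).congr fun l => ?_
    have : T l = (∑' n, b n * c (n + k) / s l ^ n) / s l ^ k := by
      rw [← tsum_div_const]
      exact tsum_congr fun n => by rw [div_div, pow_add]
    rw [this, Pi.div_apply, div_right_comm]
  have hPpos : ∀ᶠ l in atTop, 0 < P l := hP.eventually_gt_atTop 0
  have nnR : ∀ l n, 0 ≤ b n * c n / s l ^ n := fun l n =>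
    div_nonneg (mul_nonneg (hb n).le (hc n)) (pow_pos (hs0 l) n).le
  have nnT : ∀ l n, 0 ≤ b n * c (n + k) / s l ^ (n + k) := fun l n =>
    div_nonneg (mul_nonneg (hb n).le (hc _)) (pow_pos (hs0 l) _).le
  have hle : ∀ l n, b n * c (n + k) / s l ^ (n + k) ≤ b (n + k) * c (n + k) / s l ^ (n + k) :=
    fun l n => div_le_div_of_nonneg_right
      (mul_le_mul_of_nonneg_right (hbmono (Nat.le_add_right n k)) (hc _)) (pow_pos (hs0 l) _).le
  have key : ∀ ε : ℝ, 0 < ε → M' / ρ ^ k ≤ M ∧ M ≤ (1 + ε) * (M' / ρ ^ k) := by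
    intro ε hε
    have hev : ∀ᶠ n in atTop, b (n + k) ≤ (1 + ε) * b n := by
      have h1 : (1 + ε)⁻¹ < 1 := inv_lt_one_of_one_lt₀ (by linarith)
      filter_upwards [(tendsto_div_add hb1 hbq k).eventually_const_lt h1] with n hn
      have h2 : 0 < 1 + ε := by linarith
      have h3 := (lt_div_iff₀ (hb _)).1 hn
      calc b (n + k) = (1 + ε) * ((1 + ε)⁻¹ * b (n + k)) := by field_simp
        _ ≤ _ := by gcongr
    obtain ⟨N, hN⟩ := eventually_atTop.1 hev
    set K : ℝ := ∑ n ∈ Finset.range (N + k), b n * c n / ρ ^ n with hK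
    have hK0 : 0 ≤ K := Finset.sum_nonneg fun n _ =>
      div_nonneg (mul_nonneg (hb n).le (hc n)) (pow_pos hρ n).le
    have hle2 : ∀ l n, b (n + N + k) * c (n + N + k) / s l ^ (n + N + k) ≤
        (1 + ε) * (b (n + N) * c (n + N + k) / s l ^ (n + N + k)) := fun l n => by
      rw [← mul_div_assoc, ← mul_assoc]
      exact div_le_div_of_nonneg_right
        (mul_le_mul_of_nonneg_right (hN (n + N) (Nat.le_add_left N n)) (hc _))
        (pow_pos (hs0 l) _).le
    have main : ∀ l, T l ≤ R l ∧ R l ≤ K + (1 + ε) * T l := by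
      intro l
      by_cases hsum : Summable (fun n => b n * c n / s l ^ n)
      · have hsumk := (summable_nat_add_iff k).2 hsum
        have hsT : Summable (fun n => b n * c (n + k) / s l ^ (n + k)) :=
          hsumk.of_nonneg_of_le (nnT l) (hle l)
        constructor
        · calc T l ≤ ∑' n, b (n + k) * c (n + k) / s l ^ (n + k) := hsT.tsum_le_tsum (hle l) hsumk
            _ ≤ R l := by
              rw [hR]
              dsimp only
              rw [← hsum.sum_add_tsum_nat_add k]
              exact le_add_of_nonneg_left (Finset.sum_nonneg fun n _ => nnR l n)
        · have e1 : R l = ∑ n ∈ Finset.range (N + k), b n * c n / s l ^ n +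
              ∑' n, b (n + N + k) * c (n + N + k) / s l ^ (n + N + k) := by
            rw [hR]
            dsimp only
            rw [← hsum.sum_add_tsum_nat_add (N + k)]
            simp only [add_assoc]
          have hsTN := (summable_nat_add_iff N).2 hsT
          have e2 : ∑' n, b (n + N + k) * c (n + N + k) / s l ^ (n + N + k) ≤ (1 + ε) * T l := by
            calc _ ≤ ∑' n, (1 + ε) * (b (n + N) * c (n + N + k) / s l ^ (n + N + k)) :=
                  ((summable_nat_add_iff N).2 hsumk).tsum_le_tsum (hle2 l) (hsTN.mul_left _)
              _ = (1 + ε) * ∑' n, b (n + N) * c (n + N + k) / s l ^ (n + N + k) := tsum_mul_left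
              _ ≤ _ := by
                refine mul_le_mul_of_nonneg_left ?_ (by linarith)
                rw [hT]
                dsimp only
                rw [← hsT.sum_add_tsum_nat_add N]
                exact le_add_of_nonneg_left (Finset.sum_nonneg fun n _ => nnT l n)
          have e3 : ∑ n ∈ Finset.range (N + k), b n * c n / s l ^ n ≤ K := by
            refine Finset.sum_le_sum fun n _ => ?_
            exact div_le_div_of_nonneg_left (mul_nonneg (hb n).le (hc n)) (pow_pos hρ n)
              (pow_le_pow_left₀ hρ.le (hs l).le n)
          linarith
      · have hsT : ¬ Summable (fun n => b n * c (n + k) / s l ^ (n + k)) := by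
          intro h
          refine hsum ((summable_nat_add_iff (N + k)).1 ?_)
          have h2 := ((summable_nat_add_iff N).2 h).mul_left (1 + ε)
          refine h2.of_nonneg_of_le (fun n => nnR l _) fun n => ?_
          simpa only [add_assoc] using hle2 l n
        have r0 : R l = 0 := tsum_eq_zero_of_not_summable hsum
        have t0 : T l = 0 := tsum_eq_zero_of_not_summable hsT
        rw [r0, t0]
        simpa using hK0
    constructor
    · refine le_of_tendsto_of_tendsto hTlim hM ?_
      filter_upwards [hPpos] with l hl
      exact div_le_div_of_nonneg_right (main l).1 hl.le
    · have hlim : Tendsto (fun l => K / P l + (1 + ε) * (T l / P l)) atTop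
          (𝓝 (0 + (1 + ε) * (M' / ρ ^ k))) :=
        (tendsto_const_nhds.div_atTop hP).add (hTlim.const_mul _)
      rw [zero_add] at hlim
      refine le_of_tendsto_of_tendsto hM hlim ?_
      filter_upwards [hPpos] with l hl
      rw [← mul_div_assoc, ← add_div]
      exact div_le_div_of_nonneg_right (main l).2 hl.le
  have h1 := (key 1 one_pos).1
  have h2 : M ≤ M' / ρ ^ k := by
    have hlim : Tendsto (fun ε : ℝ => (1 + ε) * (M' / ρ ^ k)) (𝓝[>] 0)
        (𝓝 ((1 + 0) * (M' / ρ ^ k))) :=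
      ((continuous_const.add continuous_id).mul continuous_const).continuousAt.tendsto.mono_left
        nhdsWithin_le_nhds
    rw [add_zero, one_mul] at hlim
    exact ge_of_tendsto hlim (eventually_mem_nhdsWithin.mono fun ε hε => (key ε hε).2)
  rw [le_antisymm h2 h1]
  field_simp

lemma birk_add (φ : ShiftSpace A → ℝ) (k n : ℕ) (x : ShiftSpace A) :
    birk φ (n + k) x = birk φ k x * birk φ n (shift^[k] x) := by
  unfold birk
  rw [add_comm n k, Finset.prod_range_add]
  congr 1
  exact Finset.prod_congr rfl fun j _ => by rw [add_comm, Function.iterate_add_apply]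

lemma psin_add (ψ : ShiftSpace A → G) (k n : ℕ) (x : ShiftSpace A) :
    psin ψ (n + k) x = psin ψ k x * psin ψ n (shift^[k] x) := by
  unfold psin
  rw [add_comm n k, List.range_add, List.map_append, List.prod_append, List.map_map]
  congr 2
  exact List.map_congr_left fun j _ => by
    rw [Function.comp, add_comm, Function.iterate_add_apply]

lemma psin_congr {ψ : ShiftSpace A → G} (hψ : ∀ x y : ShiftSpace A, x.1 0 = y.1 0 → ψ x = ψ y)
    {k : ℕ} {x y : ShiftSpace A} (h : ∀ i < k, x.1 i = y.1 i) : psin ψ k x = psin ψ k y := by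
  unfold psin
  congr 1
  refine List.map_congr_left fun j hj => hψ _ _ ?_
  rw [shift_iterate_apply, shift_iterate_apply, zero_add]
  exact h j (List.mem_range.1 hj)

lemma ext_iterate (ψ : ShiftSpace A → G) (k : ℕ) (x : ShiftSpace A) :
    (ext ψ)^[k] (x, (1 : G)) = (shift^[k] x, psin ψ k x) := by
  induction k with
  | zero => simp [psin]
  | succ k ih =>
    rw [Function.iterate_succ_apply', ih, Function.iterate_succ_apply', add_comm k 1, psin_add]
    simp [ext, psin]

open Classical in
/-- Prepend the first `k` letters of `x₀` to the sequences starting with the letter `x₀ k`. -/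
noncomputable def prepend (x₀ : ShiftSpace A) (k : ℕ) (y : ShiftSpace A) : ShiftSpace A :=
  if h : y.1 0 = x₀.1 k then
    ⟨fun i => if i < k then x₀.1 i else y.1 (i - k), fun i => by
      rcases lt_trichotomy (i + 1) k with hi | hi | hi
      · simpa [hi, (Nat.lt_succ_self i).trans hi] using x₀.2 i
      · have h1 : i < k := by omega
        have h2 := x₀.2 i
        rw [hi, ← h] at h2
        simpa [h1, hi] using h2
      · have h1 : ¬ i < k := by omega
        have h2 : ¬ i + 1 < k := by omega
        have h3 : i + 1 - k = i - k + 1 := by omega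
        simpa [h1, h2, h3] using y.2 (i - k)⟩
  else x₀

lemma prepend_apply {x₀ : ShiftSpace A} {k : ℕ} {y : ShiftSpace A} (h : y.1 0 = x₀.1 k) (i : ℕ) :
    (prepend x₀ k y).1 i = if i < k then x₀.1 i else y.1 (i - k) := by
  rw [prepend, dif_pos h]

lemma shift_iterate_prepend {x₀ : ShiftSpace A} {k : ℕ} {y : ShiftSpace A}
    (h : y.1 0 = x₀.1 k) : shift^[k] (prepend x₀ k y) = y := by
  refine Subtype.ext (funext fun i => ?_)
  rw [shift_iterate_apply, prepend_apply h]
  simp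

lemma prepend_mem_cyl {x₀ : ShiftSpace A} {k : ℕ} {y : ShiftSpace A} (h : y.1 0 = x₀.1 k) :
    prepend x₀ k y ∈ cyl A (k + 1) x₀.1 := by
  intro i hi
  rw [prepend_apply h]
  split_ifs with h1
  · rfl
  · obtain rfl : i = k := by omega
    simpa using h

lemma shift_iterate_zero_of_mem_cyl {x₀ x : ShiftSpace A} {k : ℕ}
    (hx : x ∈ cyl A (k + 1) x₀.1) : (shift^[k] x).1 0 = x₀.1 k := by
  rw [shift_iterate_apply, zero_add]
  exact hx k (Nat.lt_succ_self k)

lemma injOn_shift_iterate_cyl (w : ℕ → W) (k : ℕ) :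
    Set.InjOn (shift^[k]) (cyl A (k + 1) w) := by
  intro x hx y hy hxy
  refine Subtype.ext (funext fun i => ?_)
  rcases lt_or_ge i k with hi | hi
  · rw [hx i (by omega), hy i (by omega)]
  · have := congrArg (fun z : ShiftSpace A => z.1 (i - k)) hxy
    simpa only [shift_iterate_apply, Nat.sub_add_cancel hi] using this

lemma prepend_shift_iterate {x₀ x : ShiftSpace A} {k : ℕ} (hx : x ∈ cyl A (k + 1) x₀.1) :
    prepend x₀ k (shift^[k] x) = x := by
  have h := shift_iterate_zero_of_mem_cyl hx
  exact injOn_shift_iterate_cyl _ k (prepend_mem_cyl h) hx (shift_iterate_prepend h)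

lemma image_shift_iterate_eq {x₀ : ShiftSpace A} {k : ℕ} {E : Set (ShiftSpace A)}
    (hE : E ⊆ cyl A (k + 1) x₀.1) :
    shift^[k] '' E = {y | y.1 0 = x₀.1 k} ∩ prepend x₀ k ⁻¹' E := by
  ext y
  constructor
  · rintro ⟨x, hx, rfl⟩
    exact ⟨shift_iterate_zero_of_mem_cyl (hE hx), by
      rw [Set.mem_preimage, prepend_shift_iterate (hE hx)]; exact hx⟩
  · rintro ⟨h, hy⟩
    exact ⟨_, hy, shift_iterate_prepend h⟩

lemma image_shift_iterate_cyl (x₀ : ShiftSpace A) (k : ℕ) :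
    shift^[k] '' cyl A (k + 1) x₀.1 = {y | y.1 0 = x₀.1 k} := by
  rw [image_shift_iterate_eq subset_rfl, Set.inter_eq_left]
  exact fun y hy => prepend_mem_cyl hy

lemma Zn_nonneg {φ : ShiftSpace A → ℝ} (hφ : ∀ x, 0 < φ x) (ψ : ShiftSpace A → G)
    (ξ : ShiftSpace A) (n : ℕ) : 0 ≤ Zn φ ψ ξ n :=
  tsum_nonneg fun _ => (birk_pos hφ _ _).le

lemma ZnF_nonneg {φ : ShiftSpace A → ℝ} (hφ : ∀ x, 0 < φ x) (ψ : ShiftSpace A → G)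
    (ξ : ShiftSpace A) (n : ℕ) {f : ShiftSpace A → ℝ} (hf : ∀ x, 0 ≤ f x) :
    0 ≤ ZnF φ ψ ξ n f :=
  tsum_nonneg fun _ => mul_nonneg (birk_pos hφ _ _).le (hf _)

/-- Summability over a fiber is unaffected by a weight bounded above and away from zero. -/
lemma summable_birk_mul_iff {φ : ShiftSpace A → ℝ} (hφ : ∀ x, 0 < φ x) (ψ : ShiftSpace A → G)
    (ξ : ShiftSpace A) (n : ℕ) {f : ShiftSpace A → ℝ} {K : ℝ} (h1 : ∀ x, 1 ≤ f x)
    (hK : ∀ x, f x ≤ K) :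
    Summable (fun x : {x : ShiftSpace A // shift^[n] x = ξ ∧ psin ψ n x = 1} =>
      birk φ n x.1 * f x.1) ↔
    Summable (fun x : {x : ShiftSpace A // shift^[n] x = ξ ∧ psin ψ n x = 1} =>
      birk φ n x.1) := by
  constructor
  · exact fun h => h.of_nonneg_of_le (fun x => (birk_pos hφ _ _).le) fun x =>
      le_mul_of_one_le_right (birk_pos hφ _ _).le (h1 _)
  · exact fun h => (h.mul_right K).of_nonneg_of_le
      (fun x => mul_nonneg (birk_pos hφ _ _).le (zero_le_one.trans (h1 _))) fun x =>
      mul_le_mul_of_nonneg_left (hK _) (birk_pos hφ _ _).le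

lemma Zn_le_ZnF {φ : ShiftSpace A → ℝ} (hφ : ∀ x, 0 < φ x) (ψ : ShiftSpace A → G)
    (ξ : ShiftSpace A) (n : ℕ) {f : ShiftSpace A → ℝ} {K : ℝ} (h1 : ∀ x, 1 ≤ f x)
    (hK : ∀ x, f x ≤ K) : Zn φ ψ ξ n ≤ ZnF φ ψ ξ n f := by
  have hiff := summable_birk_mul_iff hφ ψ ξ n h1 hK
  by_cases hs : Summable (fun x : {x : ShiftSpace A // shift^[n] x = ξ ∧ psin ψ n x = 1} =>
      birk φ n x.1)
  · exact hs.tsum_le_tsum (fun x => le_mul_of_one_le_right (birk_pos hφ _ _).le (h1 _))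
      (hiff.2 hs)
  · rw [Zn, tsum_eq_zero_of_not_summable hs]
    exact ZnF_nonneg hφ ψ ξ n fun x => zero_le_one.trans (h1 x)

lemma ZnF_le_mul_Zn {φ : ShiftSpace A → ℝ} (hφ : ∀ x, 0 < φ x) (ψ : ShiftSpace A → G)
    (ξ : ShiftSpace A) (n : ℕ) {f : ShiftSpace A → ℝ} {K : ℝ} (h1 : ∀ x, 1 ≤ f x)
    (hK : ∀ x, f x ≤ K) : ZnF φ ψ ξ n f ≤ Zn φ ψ ξ n * K := by
  have hiff := summable_birk_mul_iff hφ ψ ξ n h1 hK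
  by_cases hs : Summable (fun x : {x : ShiftSpace A // shift^[n] x = ξ ∧ psin ψ n x = 1} =>
      birk φ n x.1)
  · rw [Zn, ← tsum_mul_right]
    exact (hiff.2 hs).tsum_le_tsum
      (fun x => mul_le_mul_of_nonneg_left (hK _) (birk_pos hφ _ _).le) (hs.mul_right K)
  · rw [ZnF, tsum_eq_zero_of_not_summable (mt hiff.1 hs)]
    exact mul_nonneg (Zn_nonneg hφ ψ ξ n) ((zero_le_one.trans (h1 ξ)).trans (hK ξ))

/-- Change of variables along the inverse branch of `θ^k` through the cylinder of `x₀`. -/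
lemma ZnF_indicator_eq {φ : ShiftSpace A → ℝ} (hφ : ∀ x, 0 < φ x) {ψ : ShiftSpace A → G}
    (hψ : ∀ x y : ShiftSpace A, x.1 0 = y.1 0 → ψ x = ψ y) (ξ : ShiftSpace A)
    {x₀ : ShiftSpace A} {k : ℕ} (hk : psin ψ k x₀ = 1) (n : ℕ) (f : ShiftSpace A → ℝ) :
    ZnF φ ψ ξ n ({y : ShiftSpace A | y.1 0 = x₀.1 k}.indicator f) =
      ZnF φ ψ ξ (n + k)
        ((cyl A (k + 1) x₀.1).indicator fun x => f (shift^[k] x) / birk φ k x) := by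
  have hpsi : ∀ x ∈ cyl A (k + 1) x₀.1, psin ψ k x = 1 := fun x hx => by
    rw [← hk]
    exact psin_congr hψ fun i hi => hx i (hi.trans (Nat.lt_succ_self k))
  have hsupp : ∀ x : Function.support (fun x : {x : ShiftSpace A // shift^[n + k] x = ξ ∧
      psin ψ (n + k) x = 1} => birk φ (n + k) x.1 *
        (cyl A (k + 1) x₀.1).indicator (fun x => f (shift^[k] x) / birk φ k x) x.1),
      x.1.1 ∈ cyl A (k + 1) x₀.1 := fun x =>
    Set.mem_of_indicator_ne_zero (right_ne_zero_of_mul x.2)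
  refine tsum_eq_tsum_of_ne_zero_bij (fun x => ⟨shift^[k] x.1.1, ?_, ?_⟩) ?_ ?_ ?_
  · rw [← Function.iterate_add_apply]
    exact x.1.2.1
  · have h := x.1.2.2
    rw [psin_add, hpsi _ (hsupp x), one_mul] at h
    exact h
  · intro x y hxy
    exact Subtype.ext (Subtype.ext (injOn_shift_iterate_cyl _ k (hsupp x) (hsupp y)
      (congrArg Subtype.val hxy)))
  · intro y hy
    have hyC : y.1 ∈ {y : ShiftSpace A | y.1 0 = x₀.1 k} :=
      Set.mem_of_indicator_ne_zero (right_ne_zero_of_mul hy)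
    have hmem := prepend_mem_cyl hyC
    have hsh := shift_iterate_prepend hyC
    refine ⟨⟨⟨prepend x₀ k y.1, ?_, ?_⟩, ?_⟩, ?_⟩
    · rw [Function.iterate_add_apply, hsh]
      exact y.2.1
    · rw [psin_add, hpsi _ hmem, hsh, one_mul]
      exact y.2.2
    · have hf : f y.1 ≠ 0 := by
        have := right_ne_zero_of_mul hy
        rwa [Set.indicator_of_mem hyC]
          at this
      simp only [Function.mem_support]
      rw [Set.indicator_of_mem hmem, hsh]
      exact mul_ne_zero (birk_pos hφ _ _).ne' (div_ne_zero hf (birk_pos hφ _ _).ne')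
    · exact Subtype.ext hsh
  · intro x
    have hx := hsupp x
    have hx' : shift^[k] x.1.1 ∈ {y : ShiftSpace A | y.1 0 = x₀.1 k} :=
      shift_iterate_zero_of_mem_cyl hx
    dsimp only
    rw [Set.indicator_of_mem hx, Set.indicator_of_mem hx', birk_add]
    have := (birk_pos hφ k x.1.1).ne'
    field_simp

lemma exists_pos_le_birk {r C₀ : ℝ} {φ : ShiftSpace A → ℝ} (hφ : ∀ x, 0 < φ x)
    (hH : LocHolder r C₀ fun x => Real.log (φ x)) (x₀ : ShiftSpace A) (k : ℕ) :
    ∃ δ, 0 < δ ∧ ∀ x ∈ cyl A (k + 1) x₀.1, δ ≤ birk φ k x := by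
  refine ⟨∏ j ∈ Finset.range k, φ (shift^[j] x₀) * Real.exp (-(C₀ * r ^ 1)),
    Finset.prod_pos fun j _ => mul_pos (hφ _) (Real.exp_pos _), fun x hx => ?_⟩
  refine Finset.prod_le_prod (fun j _ => (mul_pos (hφ _) (Real.exp_pos _)).le) fun j hj => ?_
  have hj' := Finset.mem_range.1 hj
  have h := hH 1 le_rfl (shift^[j] x) (shift^[j] x₀) fun i hi => by
    rw [shift_iterate_apply, shift_iterate_apply]
    exact hx _ (by omega)
  rw [← Real.log_le_log_iff (mul_pos (hφ _) (Real.exp_pos _)) (hφ _),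
    Real.log_mul (hφ _).ne' (Real.exp_pos _).ne', Real.log_exp]
  have := (abs_le.1 h).1
  dsimp only at this
  linarith

/-- Multiplying by the indicator function of a clopen set on which the function is bounded
gives a bounded continuous function. -/
noncomputable def clopenIndicator {X : Type*} [TopologicalSpace X] {U : Set X} (hU : IsClopen U)
    {f : X → ℝ} (hf : Continuous f) (K : ℝ) (hK : ∀ x ∈ U, |f x| ≤ K) :
    BoundedContinuousFunction X ℝ :=
  BoundedContinuousFunction.ofNormedAddCommGroup (U.indicator f)
    (hf.indicator (by simp [hU.frontier_eq])) (max K 0) fun x => by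
      by_cases hx : x ∈ U
      · rw [Set.indicator_of_mem hx]
        exact (hK x hx).trans (le_max_left _ _)
      · rw [Set.indicator_of_notMem hx, norm_zero]
        exact le_max_right _ _

section Topology

variable [TopologicalSpace W]

lemma continuous_letter (i : ℕ) : Continuous fun x : ShiftSpace A => x.1 i :=
  (continuous_apply i).comp continuous_subtype_val

/-- `m` is the limit of the measures `m_{s_l}` tested against bounded continuous functions. -/
def WeakLimit (φ : ShiftSpace A → ℝ) (ψ : ShiftSpace A → G) (ξ : ShiftSpace A) (b s : ℕ → ℝ)
    [MeasurableSpace (ShiftSpace A)] (m : Measure (ShiftSpace A)) : Prop :=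
  ∀ f : BoundedContinuousFunction (ShiftSpace A) ℝ,
    Tendsto (fun l => (∑' n, b n * ZnF φ ψ ξ n ⇑f / s l ^ n) /
      (∑' n, b n * Zn φ ψ ξ n / s l ^ n)) atTop (𝓝 (∫ x, f x ∂m))

/-- The weak limit integrates every bounded continuous function, whatever the `σ`-algebra. -/
lemma WeakLimit.integrable {φ : ShiftSpace A → ℝ} (hφ : ∀ x, 0 < φ x) {ψ : ShiftSpace A → G}
    {ξ : ShiftSpace A} {b s : ℕ → ℝ} (hb1 : ∀ n, 1 ≤ b n) (hs : ∀ l, 0 < s l)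
    (hsum : ∀ l, Summable fun n => b n * Zn φ ψ ξ n / s l ^ n)
    (hP : Tendsto (fun l => ∑' n, b n * Zn φ ψ ξ n / s l ^ n) atTop atTop)
    [MeasurableSpace (ShiftSpace A)] {m : Measure (ShiftSpace A)} [IsFiniteMeasure m]
    (hm : WeakLimit φ ψ ξ b s m) (f : BoundedContinuousFunction (ShiftSpace A) ℝ) :
    Integrable (⇑f) m := by
  set g : BoundedContinuousFunction (ShiftSpace A) ℝ :=
    f + BoundedContinuousFunction.const _ (1 + ‖f‖) with hg
  have hgx : ∀ x, g x = f x + (1 + ‖f‖) := fun x => rfl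
  have hf : ∀ x, |f x| ≤ ‖f‖ := fun x => f.norm_coe_le_norm x
  have h1 : ∀ x, 1 ≤ g x := fun x => by
    rw [hgx]
    linarith [(abs_le.1 (hf x)).1]
  have hK : ∀ x, g x ≤ 1 + 2 * ‖f‖ := fun x => by
    rw [hgx]
    linarith [(abs_le.1 (hf x)).2]
  have hint : Integrable (⇑g) m := by
    by_contra hni
    have hlim := hm g
    rw [integral_undef hni] at hlim
    have hge : ∀ᶠ l in atTop, (1 : ℝ) ≤ (∑' n, b n * ZnF φ ψ ξ n ⇑g / s l ^ n) /
        (∑' n, b n * Zn φ ψ ξ n / s l ^ n) := by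
      filter_upwards [hP.eventually_gt_atTop 0] with l hl
      rw [one_le_div hl]
      have hle : ∀ n, b n * Zn φ ψ ξ n / s l ^ n ≤ b n * ZnF φ ψ ξ n ⇑g / s l ^ n := fun n =>
        div_le_div_of_nonneg_right (mul_le_mul_of_nonneg_left (Zn_le_ZnF hφ ψ ξ n h1 hK)
          (zero_le_one.trans (hb1 n))) (pow_pos (hs l) n).le
      refine (hsum l).tsum_le_tsum hle (((hsum l).mul_right (1 + 2 * ‖f‖)).of_nonneg_of_le
        (fun n => ?_) fun n => ?_)
      · exact (div_nonneg (mul_nonneg (zero_le_one.trans (hb1 n)) (Zn_nonneg hφ ψ ξ n))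
          (pow_pos (hs l) n).le).trans (hle n)
      · rw [div_mul_eq_mul_div, mul_assoc]
        exact div_le_div_of_nonneg_right (mul_le_mul_of_nonneg_left
          (ZnF_le_mul_Zn hφ ψ ξ n h1 hK) (zero_le_one.trans (hb1 n))) (pow_pos (hs l) n).le
    exact absurd (ge_of_tendsto hlim hge) (by norm_num)
  have : ⇑f = fun x => g x - (1 + ‖f‖) := funext fun x => by rw [hgx]; ring
  rw [this]
  exact hint.sub (integrable_const _)

lemma continuous_shift : Continuous (shift : ShiftSpace A → ShiftSpace A) :=
  continuous_induced_rng.2 (continuous_pi fun i => continuous_letter (i + 1))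

lemma continuous_birk {φ : ShiftSpace A → ℝ} (hφ : Continuous φ) (k : ℕ) :
    Continuous (birk φ k) :=
  continuous_finsetProd _ fun j _ => hφ.comp (continuous_shift.iterate j)

variable [DiscreteTopology W]

lemma hasOuterApproxClosed_shiftSpace (A : W → W → Prop) : HasOuterApproxClosed (ShiftSpace A) := by
  let := TopologicalSpace.metrizableSpaceMetric W
  let : MetricSpace (ℕ → W) := PiCountable.metricSpace
  infer_instance

lemma isClopen_letter (i : ℕ) (V : Set W) : IsClopen {x : ShiftSpace A | x.1 i ∈ V} :=
  (isClopen_discrete V).preimage (continuous_letter i)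

lemma isClopen_cyl (n : ℕ) (w : ℕ → W) : IsClopen (cyl A n w) := by
  have : cyl A n w = ⋂ i ∈ Finset.range n, {x : ShiftSpace A | x.1 i ∈ ({w i} : Set W)} := by
    ext x
    simp [cyl]
  rw [this]
  exact isClopen_biInter_finset fun i _ => isClopen_letter i _

lemma continuous_prepend (x₀ : ShiftSpace A) (k : ℕ) : Continuous (prepend x₀ k) := by
  classical
  refine continuous_induced_rng.2 (continuous_pi fun i => ?_)
  have h : (fun y : ShiftSpace A => (prepend x₀ k y).1 i) =
      (fun p : W × W => if p.1 = x₀.1 k then (if i < k then x₀.1 i else p.2) else x₀.1 i) ∘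
        fun y : ShiftSpace A => (y.1 0, y.1 (i - k)) := by
    funext y
    by_cases h : y.1 0 = x₀.1 k
    · simp [prepend_apply h, h]
    · simp [prepend, h]
  change Continuous fun y : ShiftSpace A => (prepend x₀ k y).1 i
  rw [h]
  exact continuous_of_discreteTopology.comp
    ((continuous_letter 0).prodMk (continuous_letter (i - k)))

lemma continuous_of_locHolder {r C₀ : ℝ} (hr0 : 0 < r) (hr1 : r < 1) {f : ShiftSpace A → ℝ}
    (hf : LocHolder r C₀ f) : Continuous f := by
  refine continuous_iff_continuousAt.2 fun x => Metric.tendsto_nhds.2 fun ε hε => ?_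
  have hlim : Tendsto (fun n : ℕ => C₀ * r ^ n) atTop (𝓝 0) := by
    simpa using (tendsto_pow_atTop_nhds_zero_of_lt_one hr0.le hr1).const_mul C₀
  obtain ⟨n, hn, hn1⟩ := ((hlim.eventually_lt_const hε).and (eventually_ge_atTop 1)).exists
  filter_upwards [(isClopen_cyl n x.1).isOpen.mem_nhds fun i _ => rfl] with y hy
  rw [Real.dist_eq]
  exact (hf n hn1 y x hy).trans_lt hn

lemma continuous_potential {r C₀ : ℝ} (hr0 : 0 < r) (hr1 : r < 1) {φ : ShiftSpace A → ℝ}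
    (hφ : ∀ x, 0 < φ x) (hH : LocHolder r C₀ fun x => Real.log (φ x)) : Continuous φ := by
  have := Real.continuous_exp.comp (continuous_of_locHolder hr0 hr1 hH)
  exact this.congr fun x => Real.exp_log (hφ x)

/-- The weak limit is carried by sequences over a countable set of letters. -/
lemma WeakLimit.exists_countable_letters {φ : ShiftSpace A → ℝ} (hφ : ∀ x, 0 < φ x)
    {ψ : ShiftSpace A → G} {ξ : ShiftSpace A} {b s : ℕ → ℝ}
    (hP : Tendsto (fun l => ∑' n, b n * Zn φ ψ ξ n / s l ^ n) atTop atTop)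
    [MeasurableSpace (ShiftSpace A)] [OpensMeasurableSpace (ShiftSpace A)]
    {m : Measure (ShiftSpace A)} [IsProbabilityMeasure m] (hm : WeakLimit φ ψ ξ b s m) :
    ∃ V : Set W, V.Countable ∧ ∀ i, m {x | x.1 i ∉ V} = 0 := by
  let V : Set W := ⋃ (n : ℕ) (_ : Summable fun x : {x : ShiftSpace A // shift^[n] x = ξ ∧
    psin ψ n x = 1} => birk φ n x.1) (i : ℕ), Set.range fun x : {x : ShiftSpace A //
      shift^[n] x = ξ ∧ psin ψ n x = 1} => x.1.1 i
  have hmemV : ∀ n, (Summable fun x : {x : ShiftSpace A // shift^[n] x = ξ ∧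
      psin ψ n x = 1} => birk φ n x.1) → ∀ (x : {x : ShiftSpace A // shift^[n] x = ξ ∧
      psin ψ n x = 1}) (i : ℕ), x.1.1 i ∈ V := fun n hn x i =>
    Set.mem_iUnion.2 ⟨n, Set.mem_iUnion.2 ⟨hn, Set.mem_iUnion.2 ⟨i, x, rfl⟩⟩⟩
  refine ⟨V, ?_, fun i => ?_⟩
  · refine Set.countable_iUnion fun n => Set.countable_iUnion fun hn =>
      Set.countable_iUnion fun i => ?_
    have hc := hn.countable_support
    rw [Function.support_eq_univ fun x => (birk_pos hφ n _).ne', Set.countable_univ_iff] at hc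
    exact Set.countable_range _
  · have hE : IsClopen {x : ShiftSpace A | x.1 i ∉ V} := isClopen_letter i Vᶜ
    have hEm : MeasurableSet {x : ShiftSpace A | x.1 i ∉ V} := hE.isOpen.measurableSet
    let e : BoundedContinuousFunction (ShiftSpace A) ℝ :=
      clopenIndicator hE (continuous_const (y := (1 : ℝ))) 1 fun _ _ => by simp
    let g : BoundedContinuousFunction (ShiftSpace A) ℝ :=
      BoundedContinuousFunction.const _ 1 + e
    have hgx : ∀ x, g x = 1 + {x : ShiftSpace A | x.1 i ∉ V}.indicator (fun _ => (1 : ℝ)) x :=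
      fun x => rfl
    have h0 : ∀ x, 0 ≤ {x : ShiftSpace A | x.1 i ∉ V}.indicator (fun _ => (1 : ℝ)) x :=
      fun x => Set.indicator_nonneg (fun _ _ => zero_le_one) x
    have h1 : ∀ x, {x : ShiftSpace A | x.1 i ∉ V}.indicator (fun _ => (1 : ℝ)) x ≤ 1 :=
      fun x => Set.indicator_le_self' (fun _ _ => zero_le_one) x
    have hZ : ∀ n, ZnF φ ψ ξ n ⇑g = Zn φ ψ ξ n := by
      intro n
      by_cases hn : Summable fun x : {x : ShiftSpace A // shift^[n] x = ξ ∧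
        psin ψ n x = 1} => birk φ n x.1
      · refine tsum_congr fun x => ?_
        rw [hgx, Set.indicator_of_notMem (fun h : x.1.1 i ∉ V => h (hmemV n hn x i)), add_zero,
          mul_one]
      · rw [ZnF, Zn, tsum_eq_zero_of_not_summable hn, tsum_eq_zero_of_not_summable]
        refine mt (summable_birk_mul_iff hφ ψ ξ n (K := 2) (fun x => ?_) fun x => ?_).1 hn
        · rw [hgx]; linarith [h0 x]
        · rw [hgx]; linarith [h1 x]
    have hlim := hm g
    simp only [hZ] at hlim
    have hone : ∫ x, g x ∂m = 1 := by
      refine tendsto_nhds_unique hlim (tendsto_const_nhds.congr' ?_)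
      filter_upwards [hP.eventually_gt_atTop 0] with l hl
      rw [div_self hl.ne']
    have hint : ∫ x, g x ∂m = 1 + m.real {x : ShiftSpace A | x.1 i ∉ V} := by
      simp only [hgx]
      rw [integral_add (integrable_const _)
        ((integrable_const _).indicator hEm),
        integral_indicator hEm]
      simp
    have : m.real {x : ShiftSpace A | x.1 i ∉ V} = 0 := by linarith
    exact (measureReal_eq_zero_iff).1 this

/-- On the branch of `θ^k` through the cylinder of `x₀`, the weak limit is conformal. -/
lemma WeakLimit.restrict_eq_map_withDensity {r C₀ : ℝ} (hr0 : 0 < r) (hr1 : r < 1)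
    {φ : ShiftSpace A → ℝ} (hφ : ∀ x, 0 < φ x) (hH : LocHolder r C₀ fun x => Real.log (φ x))
    {ψ : ShiftSpace A → G} (hψ : ∀ x y : ShiftSpace A, x.1 0 = y.1 0 → ψ x = ψ y)
    {ξ : ShiftSpace A} {ρ : ℝ} (hρ : 0 < ρ) {b s : ℕ → ℝ} (hb1 : ∀ n, 1 ≤ b n)
    (hbmono : Monotone b) (hbq : Tendsto (fun n => b n / b (n + 1)) atTop (𝓝 1))
    (hs : ∀ l, ρ < s l) (hst : Tendsto s atTop (𝓝 ρ))
    (hP : Tendsto (fun l => ∑' n, b n * Zn φ ψ ξ n / s l ^ n) atTop atTop)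
    [MeasurableSpace (ShiftSpace A)] [BorelSpace (ShiftSpace A)]
    {m : Measure (ShiftSpace A)} [IsFiniteMeasure m] (hm : WeakLimit φ ψ ξ b s m)
    {x₀ : ShiftSpace A} {k : ℕ} (hk : psin ψ k x₀ = 1) :
    m.restrict {y | y.1 0 = x₀.1 k} =
      ((m.restrict (cyl A (k + 1) x₀.1)).withDensity fun x =>
        ENNReal.ofReal (ρ ^ k / birk φ k x)).map (shift^[k]) := by
  have := hasOuterApproxClosed_shiftSpace A
  have hcont := continuous_birk (continuous_potential hr0 hr1 hφ hH) k
  have hshift : Continuous (shift^[k] : ShiftSpace A → ShiftSpace A) := continuous_shift.iterate k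
  have hC : IsClopen {y : ShiftSpace A | y.1 0 = x₀.1 k} := isClopen_letter 0 {x₀.1 k}
  have hU : IsClopen (cyl A (k + 1) x₀.1) := isClopen_cyl _ _
  have hD : Measurable fun x : ShiftSpace A => ENNReal.ofReal (ρ ^ k / birk φ k x) :=
    (continuous_const.div hcont fun x => (birk_pos hφ k x).ne').measurable.ennreal_ofReal
  obtain ⟨δ, hδ, hδle⟩ := exists_pos_le_birk hφ hH x₀ k
  refine ext_of_forall_lintegral_eq_of_IsFiniteMeasure fun f => ?_
  have hfm : Measurable fun x => (f x : ENNReal) := f.continuous.measurable.coe_nnreal_ennreal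
  have hfs : Measurable fun x => (f (shift^[k] x) : ENNReal) := hfm.comp hshift.measurable
  have hfc : Continuous fun x => (f x : ℝ) := NNReal.continuous_coe.comp f.continuous
  obtain ⟨K, hK⟩ : ∃ K : ℝ, ∀ x, (f x : ℝ) ≤ K := by
    obtain ⟨K, hK⟩ := f.bounded
    refine ⟨f x₀ + K, fun x => ?_⟩
    have := hK x x₀
    rw [NNReal.dist_eq] at this
    linarith [(abs_le.1 this).2]
  let f₁ := clopenIndicator hC hfc K fun x _ => (abs_of_nonneg (f x).coe_nonneg).trans_le (hK x)
  have hgc : Continuous fun x => (f (shift^[k] x) : ℝ) / birk φ k x :=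
    (hfc.comp hshift).div hcont fun x => (birk_pos hφ k x).ne'
  have hg0 : ∀ x, 0 ≤ (f (shift^[k] x) : ℝ) / birk φ k x := fun x =>
    div_nonneg (NNReal.coe_nonneg _) (birk_pos hφ k x).le
  let g := clopenIndicator hU hgc (K / δ) fun x hx => by
    rw [abs_of_nonneg (hg0 x)]
    exact div_le_div₀ ((f x).coe_nonneg.trans (hK x)) (hK _) hδ (hδle x hx)
  have hgn : ∀ x, 0 ≤ g x := fun x => Set.indicator_nonneg (fun x _ => hg0 x) x
  have hf₁n : ∀ x, 0 ≤ f₁ x := fun x => Set.indicator_nonneg (fun x _ => (f x).coe_nonneg) x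
  have key : ∫ x, f₁ x ∂m = ρ ^ k * ∫ x, g x ∂m := by
    refine limit_translate (c := fun n => ZnF φ ψ ξ n ⇑g) hb1 hbmono hbq
      (fun n => ZnF_nonneg hφ ψ ξ n hgn) hρ hs hst hP k (hm g) ?_
    have hZ : ∀ n, ZnF φ ψ ξ n ⇑f₁ = ZnF φ ψ ξ (n + k) ⇑g := fun n =>
      ZnF_indicator_eq hφ hψ ξ hk n _
    simpa only [hZ] using hm f₁
  have hL : ∫⁻ x in {y : ShiftSpace A | y.1 0 = x₀.1 k}, (f x : ENNReal) ∂m =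
      ENNReal.ofReal (∫ x, f₁ x ∂m) := by
    rw [ofReal_integral_eq_lintegral_ofReal (f₁.integrable m) (ae_of_all _ hf₁n),
      ← lintegral_indicator hC.isOpen.measurableSet]
    refine lintegral_congr fun x => ?_
    rw [show f₁ x = {y : ShiftSpace A | y.1 0 = x₀.1 k}.indicator (fun x => (f x : ℝ)) x from rfl]
    by_cases hx : x ∈ {y : ShiftSpace A | y.1 0 = x₀.1 k}
    · rw [Set.indicator_of_mem hx, Set.indicator_of_mem hx, ENNReal.ofReal_coe_nnreal]
    · rw [Set.indicator_of_notMem hx, Set.indicator_of_notMem hx, ENNReal.ofReal_zero]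
  rw [hL, key, lintegral_map hfm hshift.measurable,
    lintegral_withDensity_eq_lintegral_mul _ hD hfs,
    ← integral_const_mul, ofReal_integral_eq_lintegral_ofReal ((g.integrable m).const_mul _)
      (ae_of_all _ fun x => mul_nonneg (pow_pos hρ k).le (hgn x)),
    ← lintegral_indicator hU.isOpen.measurableSet]
  refine lintegral_congr fun x => ?_
  rw [show g x = (cyl A (k + 1) x₀.1).indicator
    (fun x => (f (shift^[k] x) : ℝ) / birk φ k x) x from rfl]
  by_cases hx : x ∈ cyl A (k + 1) x₀.1
  · rw [Set.indicator_of_mem hx, Set.indicator_of_mem hx, Pi.mul_apply,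
      ← ENNReal.ofReal_coe_nnreal,
      ← ENNReal.ofReal_mul (div_nonneg (pow_pos hρ k).le (birk_pos hφ k x).le)]
    congr 1
    ring
  · rw [Set.indicator_of_notMem hx, Set.indicator_of_notMem hx, mul_zero, ENNReal.ofReal_zero]

lemma measurableSet_image_shift_iterate [MeasurableSpace (ShiftSpace A)]
    [BorelSpace (ShiftSpace A)] {x₀ : ShiftSpace A} {k : ℕ} {E : Set (ShiftSpace A)}
    (hE : MeasurableSet E) (hEU : E ⊆ cyl A (k + 1) x₀.1) :
    MeasurableSet (shift^[k] '' E) := by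
  rw [image_shift_iterate_eq hEU]
  exact (isClopen_letter 0 {x₀.1 k}).isOpen.measurableSet.inter
    ((continuous_prepend x₀ k).measurable hE)

lemma measure_image_of_subset_cyl [MeasurableSpace (ShiftSpace A)] [BorelSpace (ShiftSpace A)]
    {m : Measure (ShiftSpace A)} {D : ShiftSpace A → ENNReal} {x₀ : ShiftSpace A} {k : ℕ}
    (h : m.restrict {y | y.1 0 = x₀.1 k} =
      ((m.restrict (cyl A (k + 1) x₀.1)).withDensity D).map (shift^[k]))
    {E : Set (ShiftSpace A)} (hE : MeasurableSet E) (hEU : E ⊆ cyl A (k + 1) x₀.1) :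
    m (shift^[k] '' E) = ∫⁻ x in E, D x ∂m := by
  have hF := measurableSet_image_shift_iterate hE hEU
  have hshift : Measurable (shift^[k] : ShiftSpace A → ShiftSpace A) :=
    (continuous_shift.iterate k).measurable
  have h1 : m (shift^[k] '' E) = m.restrict {y | y.1 0 = x₀.1 k} (shift^[k] '' E) := by
    rw [Measure.restrict_apply hF, Set.inter_eq_left.2]
    exact (Set.image_mono hEU).trans (image_shift_iterate_cyl x₀ k).subset
  have h2 : shift^[k] ⁻¹' (shift^[k] '' E) ∩ cyl A (k + 1) x₀.1 = E := by
    ext x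
    constructor
    · rintro ⟨⟨y, hy, hyx⟩, hx⟩
      rwa [← injOn_shift_iterate_cyl _ k (hEU hy) hx hyx]
    · exact fun hx => ⟨⟨x, hx, rfl⟩, hEU hx⟩
  rw [h1, h, Measure.map_apply hshift hF, withDensity_apply _ (hshift hF),
    Measure.restrict_restrict (hshift hF), h2]

/-- Conformality on the branches of `θ^k` implies conformality on every set where `θ^k` is
injective, provided the measure is carried by sequences over a countable set of letters. -/
lemma measure_image_of_injOn [MeasurableSpace (ShiftSpace A)] [BorelSpace (ShiftSpace A)]
    {m : Measure (ShiftSpace A)} {D : ShiftSpace A → ENNReal} {V : Set W} (hVc : V.Countable)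
    (hV : ∀ i, m {x | x.1 i ∉ V} = 0) {k : ℕ} {B : Set (ShiftSpace A)} (hB : MeasurableSet B)
    (hinj : Set.InjOn (shift^[k]) B)
    (hbr : ∀ x₀ ∈ B, ∀ E ⊆ cyl A (k + 1) x₀.1, MeasurableSet E →
      m (shift^[k] '' E) = ∫⁻ x in E, D x ∂m) :
    m (shift^[k] '' B) = ∫⁻ x in B, D x ∂m := by
  have := hVc.to_subtype
  let S : (Fin (k + 1) → V) → Set (ShiftSpace A) := fun w => {x | ∀ i : Fin (k + 1), x.1 i = w i}
  have hSm : ∀ w, MeasurableSet (B ∩ S w) := fun w => by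
    have : S w = ⋂ i : Fin (k + 1), {x : ShiftSpace A | x.1 i ∈ ({(w i : W)} : Set W)} := by
      ext x
      simp [S]
    rw [this]
    exact hB.inter (MeasurableSet.iInter fun i => (isClopen_letter _ _).isOpen.measurableSet)
  have hSU : ∀ w, ∀ x₀ ∈ S w, B ∩ S w ⊆ cyl A (k + 1) x₀.1 := fun w x₀ hx₀ x hx i hi =>
    (hx.2 ⟨i, hi⟩).trans (hx₀ ⟨i, hi⟩).symm
  have hdisj : Pairwise (Function.onFun Disjoint fun w => B ∩ S w) := fun w w' hww => by
    refine Set.disjoint_left.2 fun x hx hx' => hww (funext fun i => Subtype.ext ?_)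
    rw [← hx.2 i, ← hx'.2 i]
  have hdisj' : Pairwise (Function.onFun Disjoint fun w => shift^[k] '' (B ∩ S w)) :=
    fun w w' hww => Set.disjoint_left.2 <| by
      rintro _ ⟨x, hx, rfl⟩ ⟨y, hy, hxy⟩
      rw [hinj hy.1 hx.1 hxy] at hy
      exact Set.disjoint_left.1 (hdisj hww) hx hy
  have hbrS : ∀ w, MeasurableSet (shift^[k] '' (B ∩ S w)) ∧
      m (shift^[k] '' (B ∩ S w)) = ∫⁻ x in B ∩ S w, D x ∂m := fun w => by
    rcases (B ∩ S w).eq_empty_or_nonempty with h | ⟨x₀, hx₀⟩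
    · simp [h]
    · exact ⟨measurableSet_image_shift_iterate (hSm w) (hSU w x₀ hx₀.2),
        hbr x₀ hx₀.1 _ (hSU w x₀ hx₀.2) (hSm w)⟩
  have hmain : m (shift^[k] '' ⋃ w, B ∩ S w) = ∫⁻ x in ⋃ w, B ∩ S w, D x ∂m := by
    rw [Set.image_iUnion, measure_iUnion hdisj' fun w => (hbrS w).1,
      lintegral_iUnion hSm hdisj]
    exact tsum_congr fun w => (hbrS w).2
  have hsub : (⋃ w, B ∩ S w) ⊆ B := Set.iUnion_subset fun w => Set.inter_subset_left
  have hrest : ∀ x ∈ B \ ⋃ w, B ∩ S w, ∃ i < k + 1, x.1 i ∉ V := by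
    rintro x ⟨hxB, hx⟩
    by_contra hcon
    refine hx (Set.mem_iUnion.2 ⟨fun i => ⟨x.1 i, ?_⟩, hxB, fun i => rfl⟩)
    by_contra hi
    exact hcon ⟨i, i.2, hi⟩
  have hnull : m (B \ ⋃ w, B ∩ S w) = 0 := by
    refine measure_mono_null (t := ⋃ i, {x : ShiftSpace A | x.1 i ∉ V}) (fun x hx => ?_)
      (measure_iUnion_null hV)
    obtain ⟨i, -, hi⟩ := hrest x hx
    exact Set.mem_iUnion.2 ⟨i, hi⟩
  have hnull' : m (shift^[k] '' (B \ ⋃ w, B ∩ S w)) = 0 := by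
    refine measure_mono_null (t := {y : ShiftSpace A | y.1 0 ∉ V} ∪
      ⋃ a ∈ {a ∈ V | m {y : ShiftSpace A | y.1 0 = a} = 0}, {y : ShiftSpace A | y.1 0 = a}) ?_
      (measure_union_null (hV 0) ((measure_biUnion_null_iff (hVc.mono (Set.sep_subset _ _))).2
        fun a ha => ha.2))
    rintro _ ⟨x, hx, rfl⟩
    by_cases ha : (shift^[k] x).1 0 ∈ V
    · refine Or.inr (Set.mem_biUnion (x := (shift^[k] x).1 0) ⟨ha, ?_⟩ rfl)
      obtain ⟨i, hik, hi⟩ := hrest x hx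
      have hU : m (cyl A (k + 1) x.1) = 0 := by
        refine measure_mono_null (fun y hy => ?_) (hV i)
        rw [Set.mem_ofPred_eq, hy i hik]
        exact hi
      have h := hbr x hx.1 _ subset_rfl (isClopen_cyl _ _).isOpen.measurableSet
      rw [image_shift_iterate_cyl, setLIntegral_measure_zero _ _ hU] at h
      rw [shift_iterate_apply, zero_add]
      exact h
    · exact Or.inl ha
  have hB1 : (⋃ w, B ∩ S w : Set (ShiftSpace A)) =ᵐ[m] B :=
    hsub.eventuallyLE.antisymm (ae_le_set.2 hnull)
  rw [← setLIntegral_congr hB1, ← hmain]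
  refine le_antisymm ?_ (measure_mono (Set.image_mono hsub))
  calc m (shift^[k] '' B) ≤ m (shift^[k] '' (⋃ w, B ∩ S w) ∪
        shift^[k] '' (B \ ⋃ w, B ∩ S w)) := by
        rw [← Set.image_union, Set.union_sdiff_cancel hsub]
    _ ≤ _ := measure_union_le _ _
    _ = _ := by rw [hnull', add_zero]

end Topology

/-- If bounded continuous functions are a.e. measurable, then Borel sets are null-measurable. -/
lemma nullMeasurableSet_of_borel {X : Type*} [TopologicalSpace X] [HasOuterApproxClosed X]
    {mX : MeasurableSpace X} {m : Measure X}
    (hm : ∀ f : BoundedContinuousFunction X ℝ, AEStronglyMeasurable (⇑f) m) {E : Set X}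
    (hE : MeasurableSet[borel X] E) : NullMeasurableSet E m := by
  rw [borel_eq_generateFrom_isClosed] at hE
  induction E, hE using MeasurableSpace.generateFrom_induction with
  | hC F hF _ =>
    obtain ⟨f, hf1, -, hlim⟩ := HasOuterApproxClosed.exAppr F hF
    refine (aemeasurable_indicator_const_iff (1 : NNReal)).1
      (aemeasurable_of_tendsto_metrizable_ae atTop (fun n => ?_)
        (ae_of_all _ fun x => tendsto_pi_nhds.1 hlim x))
    have h := hm (BoundedContinuousFunction.ofNormedAddCommGroup (fun x => (f n x : ℝ))
      (NNReal.continuous_coe.comp (f n).continuous) 1 fun x => by simpa using hf1 n x)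
    simpa using h.aemeasurable.real_toNNReal
  | empty => exact nullMeasurableSet_empty
  | compl s _ hs => exact hs.compl
  | iUnion s _ hs => exact NullMeasurableSet.iUnion hs

/-- A measure extends to any larger `σ`-algebra of null-measurable sets. -/
lemma exists_trim_eq {X : Type*} {m₁ m₂ : MeasurableSpace X} (hle : m₁ ≤ m₂) (m : Measure[m₁] X)
    (hm : ∀ E, MeasurableSet[m₂] E → @NullMeasurableSet X m₁ E m) :
    ∃ μ : Measure[m₂] X, (∀ E, μ E = m E) ∧ μ.trim hle = m := by
  have hcar : m₂ ≤ (@Measure.toOuterMeasure X m₁ m).caratheodory := fun E hE t =>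
    (@measure_inter_add_sdiff₀ X m₁ m E t (hm E hE)).symm
  let μ : Measure[m₂] X := @OuterMeasure.toMeasure X m₂ (@Measure.toOuterMeasure X m₁ m) hcar
  have hmeas : ∀ E, MeasurableSet[m₂] E → μ E = m E := fun E hE =>
    @toMeasure_apply X m₂ _ hcar E hE
  refine ⟨μ, fun E => le_antisymm ?_ (@le_toMeasure_apply X m₂ _ hcar E), ?_⟩
  · obtain ⟨t, ht, htm, hmt⟩ := @exists_measurable_superset X m₁ m E
    rw [← hmt]
    exact (measure_mono ht).trans (hmeas t (hle t htm)).le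
  · refine @Measure.ext X m₁ _ _ fun E hE => ?_
    rw [trim_measurableSet_eq hle hE]
    exact hmeas E (hle E hE)

lemma measurableSpace_le_borel [TopologicalSpace W] [DiscreteTopology W] [MeasurableSpace W]
    (A : W → W → Prop) :
    (inferInstance : MeasurableSpace (ShiftSpace A)) ≤ borel (ShiftSpace A) := by
  refine measurable_iff_comap_le.1 ((@measurable_pi_iff _ _ _ (borel _) _ _).2 fun i V _ => ?_)
  exact MeasurableSpace.measurableSet_generateFrom (isClopen_letter i V).isOpen

/-- Lemma 4.2: if the measures `m_{s_l}` (viewed on `Σ ≅ X_id`) converge weakly* to a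
probability measure `m`, then `m(θ^k(B)) = ∫_B ρ^k/Φ_k dm` for every Borel `B` and `k`
such that `T^k|_{B×{id}}` is injective with image in `X_id`. -/
theorem conformal_limit_lemma [MeasurableSpace W] [TopologicalSpace W] [DiscreteTopology W]
    (r C₀ : ℝ) (hr0 : 0 < r) (hr1 : r < 1)
    (φ : ShiftSpace A → ℝ) (hφ : ∀ x, 0 < φ x)
    (hH : LocHolder r C₀ (fun x => Real.log (φ x)))
    (ψ : ShiftSpace A → G) (hψ : ∀ x y : ShiftSpace A, x.1 0 = y.1 0 → ψ x = ψ y)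
    (ξ : ShiftSpace A) (ρ : ℝ) (hρpos : 0 < ρ)
    (hbdd : IsBoundedUnder (· ≤ ·) atTop (fun n : ℕ => Zn φ ψ ξ n ^ (1 / (n : ℝ))))
    (hρ : limsup (fun n : ℕ => Zn φ ψ ξ n ^ (1 / (n : ℝ))) atTop = ρ)
    (b : ℕ → ℝ) (hb1 : ∀ n, 1 ≤ b n) (hbmono : Monotone b)
    (hbq : Tendsto (fun n => b n / b (n + 1)) atTop (𝓝 1))
    (hdiv : ¬ Summable (fun n => b n * Zn φ ψ ξ n / ρ ^ n))
    (hcon : ∀ t : ℝ, ρ < t → Summable (fun n => b n * Zn φ ψ ξ n / t ^ n))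
    (s : ℕ → ℝ) (hsa : Antitone s) (hsρ : ∀ l, ρ < s l) (hst : Tendsto s atTop (𝓝 ρ))
    (m : Measure (ShiftSpace A)) (hm : IsProbabilityMeasure m)
    (hwk : ∀ f : BoundedContinuousFunction (ShiftSpace A) ℝ,
      Tendsto (fun l => (∑' n, b n * ZnF φ ψ ξ n ⇑f / s l ^ n) /
        (∑' n, b n * Zn φ ψ ξ n / s l ^ n)) atTop (𝓝 (∫ x, f x ∂m)))
    (B : Set (ShiftSpace A)) (k : ℕ) (hB : MeasurableSet B)
    (hinj : Set.InjOn (fun x => (ext ψ)^[k] (x, (1 : G))) B)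
    (hid : ∀ x ∈ B, psin ψ k x = 1) :
    m (shift^[k] '' B) = ∫⁻ x in B, ENNReal.ofReal (ρ ^ k / birk φ k x) ∂m := by
  have hs0 : ∀ l, 0 < s l := fun l => hρpos.trans (hsρ l)
  have hP : Tendsto (fun l => ∑' n, b n * Zn φ ψ ξ n / s l ^ n) atTop atTop :=
    tendsto_tsum_div_pow_atTop
      (fun n => mul_nonneg (zero_le_one.trans (hb1 n)) (Zn_nonneg hφ ψ ξ n)) hρpos hdiv hcon hsρ hst
  have happr := hasOuterApproxClosed_shiftSpace A
  have hle := measurableSpace_le_borel A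
  have hae : ∀ f : BoundedContinuousFunction (ShiftSpace A) ℝ, AEStronglyMeasurable (⇑f) m :=
    fun f => (WeakLimit.integrable hφ hb1 hs0 (fun l => hcon _ (hsρ l)) hP hwk f).1
  have hnull : ∀ E, MeasurableSet[borel (ShiftSpace A)] E → NullMeasurableSet E m :=
    fun E hE => nullMeasurableSet_of_borel hae hE
  have hD : Continuous fun x => ENNReal.ofReal (ρ ^ k / birk φ k x) :=
    ENNReal.continuous_ofReal.comp (continuous_const.div
      (continuous_birk (continuous_potential hr0 hr1 hφ hH) k) fun x => (birk_pos hφ k x).ne')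
  have hDae : AEMeasurable (fun x => ENNReal.ofReal (ρ ^ k / birk φ k x)) m :=
    NullMeasurable.aemeasurable fun V hV =>
      hnull _ (@Continuous.measurable _ _ _ (borel _)
        (@OpensMeasurableSpace.mk _ _ (borel _) le_rfl) _ _ _ _ hD _ hV)
  obtain ⟨μ, hμ, hμm⟩ := exists_trim_eq hle m hnull
  have hinj' : Set.InjOn (shift^[k]) B := fun x hx y hy hxy =>
    hinj hx hy (by simp only [ext_iterate, hid x hx, hid y hy, hxy])
  have hint : ∫⁻ x in B, ENNReal.ofReal (ρ ^ k / birk φ k x) ∂m =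
      @lintegral _ (borel _) (@Measure.restrict _ (borel _) μ B)
        fun x => ENNReal.ofReal (ρ ^ k / birk φ k x) := by
    have h1 : m.restrict B = (μ.restrict B).trim hle := by
      rw [← hμm, restrict_trim hle μ hB]
    have h2 := hDae.restrict (s := B)
    rw [h1] at h2 ⊢
    exact lintegral_trim_ae hle h2
  have hwk' : @WeakLimit _ _ _ _ _ φ ψ ξ b s (borel _) μ := fun f => by
    have h1 := hae f
    have h2 := hwk f
    rw [← hμm] at h1 h2
    rwa [← integral_trim_ae hle h1] at h2
  rw [hint, ← hμ]
  have hB' : MeasurableSet[borel (ShiftSpace A)] B := hle B hB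
  have hprob : @IsProbabilityMeasure _ (borel _) μ :=
    @IsProbabilityMeasure.mk _ (borel _) μ ((hμ _).trans hm.measure_univ)
  let _ : MeasurableSpace (ShiftSpace A) := borel (ShiftSpace A)
  have _ : BorelSpace (ShiftSpace A) := ⟨rfl⟩
  obtain ⟨V, hVc, hV⟩ := WeakLimit.exists_countable_letters hφ hP hwk'
  exact measure_image_of_injOn hVc hV hB' hinj' fun x₀ hx₀ E hEU hE =>
    measure_image_of_subset_cyl (WeakLimit.restrict_eq_map_withDensity hr0 hr1 hφ hH hψ hρpos hb1
      hbmono hbq hsρ hst hP hwk' (hid x₀ hx₀)) hE hEU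

end GroupExt
end
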